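/- arXiv:1309.5578 — 2 statements merged into one kernel-verified Lean document; each statement's English description precedes it below -/
import Mathlib

section
/- Let $\mathcal{N}_3(H)$ denote the number of triples $(a_1,a_2,a_3)$ of positive integers with $1 \le a_1,a_2,a_3 \le H$ such that $\gcd(a_i,a_j) \ne 1$ for all $1 \le i < j \le 3$. Then there exists a constant $C > 0$ such that for all positive integers $H \ge 2$, $|\mathcal{N}_3(H) - \rho H^3| \le C H^2 (\log H)^2$, where $\rho = 1 - 3/\zeta(2) + 3\prod_{p\ \mathrm{prime}}(1 - (2p-1)/p^3) - \prod_{p\ \mathrm{prime}}(1 - (3p-2)/p^3)$. -/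
open Finset

/-- The number of pairwise non-coprime triples `(a₁,a₂,a₃)` with `1 ≤ aᵢ ≤ H`. -/
def N3 (H : ℕ) : ℕ :=
  ((Finset.Icc 1 H ×ˢ Finset.Icc 1 H ×ˢ Finset.Icc 1 H).filter
    (fun a => Nat.gcd a.1 a.2.1 ≠ 1 ∧ Nat.gcd a.1 a.2.2 ≠ 1 ∧ Nat.gcd a.2.1 a.2.2 ≠ 1)).card

/-- The arithmetic function supported on squarefree numbers, equal to `∏ p ∣ d, u p` there. -/
noncomputable def squarefreeProd (u : ℕ → ℝ) : ArithmeticFunction ℝ where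
  toFun d := if Squarefree d then ∏ p ∈ d.primeFactors, u p else 0
  map_zero' := by simp

theorem squarefreeProd_apply (u : ℕ → ℝ) (d : ℕ) :
    squarefreeProd u d = if Squarefree d then ∏ p ∈ d.primeFactors, u p else 0 := rfl

theorem squarefreeProd_one (u : ℕ → ℝ) : squarefreeProd u 1 = 1 := by
  simp [squarefreeProd_apply]

theorem squarefreeProd_mul (u : ℕ → ℝ) {m n : ℕ} (h : m.Coprime n) :
    squarefreeProd u (m * n) = squarefreeProd u m * squarefreeProd u n := by
  simp only [squarefreeProd_apply, Nat.squarefree_mul h]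
  by_cases hm : Squarefree m <;> by_cases hn : Squarefree n <;> simp [hm, hn]
  rw [h.primeFactors_mul, prod_union h.disjoint_primeFactors]

theorem squarefreeProd_prime_pow (u : ℕ → ℝ) {p : ℕ} (hp : p.Prime) :
    ∑' e, squarefreeProd u (p ^ e) = 1 + u p := by
  rw [tsum_eq_sum (s := range 2)]
  · simp [sum_range_succ, squarefreeProd_apply, hp.primeFactors, hp.prime.squarefree]
  · intro e he
    simp only [mem_range, not_lt] at he
    rw [squarefreeProd_apply, if_neg]
    rw [Nat.squarefree_pow_iff hp.ne_one (by omega)]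
    omega

theorem squarefreeProd_mul_weight (u : ℕ → ℝ) (w : ℕ →* ℝ) (d : ℕ) :
    squarefreeProd (fun p ↦ u p * w p) d = squarefreeProd u d * w d := by
  simp only [squarefreeProd_apply]
  split_ifs with hd
  · rw [prod_mul_distrib, ← map_prod, Nat.prod_primeFactors_of_squarefree hd]
  · simp

theorem squarefreeProd_mul_zeta (u : ℕ → ℝ) {n : ℕ} (hn : n ≠ 0) :
    (squarefreeProd u * (ArithmeticFunction.zeta : ArithmeticFunction ℝ)) n =
      ∏ p ∈ n.primeFactors, (1 + u p) := by
  rw [ArithmeticFunction.coe_mul_zeta_apply, prod_one_add]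
  simp only [squarefreeProd_apply]
  rw [← sum_filter, Nat.sum_divisors_filter_squarefree hn, Nat.factors_eq]
  refine sum_congr rfl fun t ht ↦ ?_
  have ht' : t ⊆ n.primeFactors := by
    intro x hx
    simpa using mem_powerset.1 ht hx
  rw [prod_val, Function.id_def,
    Nat.primeFactors_prod fun p hp ↦ Nat.prime_of_mem_primeFactors (ht' hp)]

theorem sum_prod_primeFactors (u : ℕ → ℝ) (H : ℕ) :
    ∑ n ∈ Icc 1 H, ∏ p ∈ n.primeFactors, (1 + u p) =
      ∑ d ∈ Icc 1 H, squarefreeProd u d * ((H / d : ℕ) : ℝ) := by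
  have := ArithmeticFunction.sum_Ioc_mul_zeta_eq_sum (squarefreeProd u) H
  refine Eq.trans ?_ this
  exact sum_congr rfl fun n hn ↦ (squarefreeProd_mul_zeta u (by simp at hn; omega)).symm

theorem abs_squarefreeProd_le {u : ℕ → ℝ} {F G : ArithmeticFunction ℝ}
    (hF : F.IsMultiplicative) (hG : G.IsMultiplicative) (hF0 : ∀ n, 0 ≤ F n) (hG0 : ∀ n, 0 ≤ G n)
    (hu : ∀ p, p.Prime → |u p| ≤ F p + G p) (d : ℕ) : |squarefreeProd u d| ≤ (F * G) d := by
  rw [squarefreeProd_apply]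
  split_ifs with hd
  · rw [← hF.prodPrimeFactors_add_of_squarefree hG hd,
      ArithmeticFunction.prodPrimeFactors_apply hd.ne_zero, abs_prod]
    exact prod_le_prod (fun _ _ ↦ abs_nonneg _) fun p hp ↦ hu p (Nat.prime_of_mem_primeFactors hp)
  · rw [abs_zero, ArithmeticFunction.mul_apply]
    exact sum_nonneg fun x _ ↦ mul_nonneg (hF0 _) (hG0 _)

theorem sum_range_abs_squarefreeProd_le {u : ℕ → ℝ} {F G : ArithmeticFunction ℝ}
    (hF : F.IsMultiplicative) (hG : G.IsMultiplicative) (hF0 : ∀ n, 0 ≤ F n) (hG0 : ∀ n, 0 ≤ G n)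
    (hu : ∀ p, p.Prime → |u p| ≤ F p + G p) {A B : ℝ}
    (hA : ∀ N, ∑ n ∈ Ioc 0 N, F n ≤ A) (hB : ∀ N, ∑ n ∈ Ioc 0 N, G n ≤ B) (N : ℕ) :
    ∑ d ∈ range N, |squarefreeProd u d| ≤ A * B := by
  have hA0 : 0 ≤ A := by simpa using hA 0
  calc ∑ d ∈ range N, |squarefreeProd u d|
      ≤ ∑ d ∈ Ioc 0 N, |squarefreeProd u d| := by
        rw [← sum_subset (filter_subset (· ≠ 0) (range N))]
        · refine sum_le_sum_of_subset_of_nonneg (fun x hx ↦ ?_) fun _ _ _ ↦ abs_nonneg _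
          simp at hx ⊢; omega
        · intro x hx hx'
          obtain rfl : x = 0 := by simp at hx hx'; tauto
          simp
    _ ≤ ∑ d ∈ Ioc 0 N, (F * G) d :=
        sum_le_sum fun d _ ↦ abs_squarefreeProd_le hF hG hF0 hG0 hu d
    _ = ∑ n ∈ Ioc 0 N, F n * ∑ m ∈ Ioc 0 (N / n), G m :=
        ArithmeticFunction.sum_Ioc_mul_eq_sum_sum F G N
    _ ≤ ∑ n ∈ Ioc 0 N, F n * B :=
        sum_le_sum fun n _ ↦ mul_le_mul_of_nonneg_left (hB _) (hF0 n)
    _ ≤ A * B := by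
        rw [← sum_mul]
        exact mul_le_mul_of_nonneg_right (hA N) (by simpa using hB 0)

theorem abs_floor_div_sub_le {H d : ℕ} {ε : ℝ} (hε : 0 ≤ ε) (hε1 : ε ≤ 1) (hd : d ≠ 0) :
    |((H / d : ℕ) : ℝ) - H / d| ≤ (H : ℝ) ^ ε * (d : ℝ) ^ (-ε) := by
  have hd' : (0 : ℝ) < d := by positivity
  have h1 : ((H / d : ℕ) : ℝ) ≤ H / d := Nat.cast_div_le
  have h2 : (H : ℝ) / d < (H / d : ℕ) + 1 := by
    rw [div_lt_iff₀ hd']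
    exact_mod_cast (by simpa [mul_comm] using Nat.lt_mul_div_succ H (Nat.pos_of_ne_zero hd) :
      H < (H / d + 1) * d)
  have h3 : (0 : ℝ) ≤ (H / d : ℕ) := by positivity
  have hx : (0 : ℝ) ≤ (H : ℝ) / d := by positivity
  rw [Real.rpow_neg hd'.le, ← div_eq_mul_inv, ← Real.div_rpow (by positivity) hd'.le,
    abs_sub_comm, abs_of_nonneg (by linarith)]
  rcases le_total ((H : ℝ) / d) 1 with h | h
  · rcases hx.eq_or_lt with h0 | h0
    · rw [← h0] at *
      have := Real.rpow_nonneg (le_refl (0 : ℝ)) ε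
      linarith
    · have := Real.rpow_le_rpow_of_exponent_ge h0 h hε1
      rw [Real.rpow_one] at this
      linarith
  · have := Real.one_le_rpow h hε
    linarith

/-- Mean value of the strongly multiplicative function `∏ p ∣ n, (1 + u p)`. -/
theorem mean_value_prod_primeFactors {u : ℕ → ℝ} {F G : ArithmeticFunction ℝ} {ε : ℝ}
    (hε : 0 ≤ ε) (hε1 : ε ≤ 1)
    (hF : F.IsMultiplicative) (hG : G.IsMultiplicative) (hF0 : ∀ n, 0 ≤ F n) (hG0 : ∀ n, 0 ≤ G n)
    (hu : ∀ p, p.Prime → |u p| * (p : ℝ) ^ (-ε) ≤ F p + G p) {A B : ℝ}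
    (hA : ∀ N, ∑ n ∈ Ioc 0 N, F n ≤ A) (hB : ∀ N, ∑ n ∈ Ioc 0 N, G n ≤ B) :
    Multipliable (fun p : Nat.Primes ↦ 1 + u p / p) ∧ ∀ H : ℕ,
      |∑ n ∈ Icc 1 H, ∏ p ∈ n.primeFactors, (1 + u p) - H * ∏' p : Nat.Primes, (1 + u p / p)| ≤
        (H : ℝ) ^ ε * (A * B) := by
  let w : ℕ →* ℝ :=
    { toFun := fun d ↦ (d : ℝ) ^ (-ε)
      map_one' := by simp
      map_mul' := fun x y ↦ by
        rw [Nat.cast_mul, Real.mul_rpow (Nat.cast_nonneg _) (Nat.cast_nonneg _)] }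
  let v : ℕ →* ℝ :=
    { toFun := fun d ↦ (d : ℝ)⁻¹
      map_one' := by simp
      map_mul' := fun x y ↦ by rw [Nat.cast_mul, mul_inv] }
  have hw (d : ℕ) : w d = (d : ℝ) ^ (-ε) := rfl
  have hv (d : ℕ) : v d = (d : ℝ)⁻¹ := rfl
  have hw0 (d : ℕ) : 0 ≤ w d := by rw [hw]; positivity
  have habs (d : ℕ) : |squarefreeProd (fun p ↦ u p * w p) d| = |squarefreeProd u d| * w d := by
    rw [squarefreeProd_mul_weight, abs_mul, abs_of_nonneg (hw0 d)]
  have hu' (p : ℕ) (hp : p.Prime) : |u p * w p| ≤ F p + G p := by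
    rw [abs_mul, abs_of_nonneg (hw0 p)]
    exact hu p hp
  have hbound := sum_range_abs_squarefreeProd_le hF hG hF0 hG0 hu' hA hB
  simp only [habs] at hbound
  have hnn (d : ℕ) : 0 ≤ |squarefreeProd u d| * w d := mul_nonneg (abs_nonneg _) (hw0 d)
  have hsum := summable_of_sum_range_le hnn hbound
  have htsum := Real.tsum_le_of_sum_range_le hnn hbound
  have hnorm : Summable (fun d ↦ ‖squarefreeProd (fun p ↦ u p * v p) d‖) := by
    refine Summable.of_nonneg_of_le (fun _ ↦ norm_nonneg _) (fun d ↦ ?_) hsum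
    rw [squarefreeProd_mul_weight, norm_mul, Real.norm_eq_abs, hv, hw]
    refine mul_le_mul_of_nonneg_left ?_ (abs_nonneg _)
    rcases Nat.eq_zero_or_pos d with rfl | hd
    · simp only [Nat.cast_zero, inv_zero, norm_zero]; positivity
    · rw [Real.norm_of_nonneg (by positivity), ← Real.rpow_neg_one]
      exact Real.rpow_le_rpow_of_exponent_le (by exact_mod_cast hd) (by linarith)
  have hprod := EulerProduct.eulerProduct_hasProd (squarefreeProd_one _)
    (squarefreeProd_mul (fun p ↦ u p * v p)) hnorm (by simp)
  have hfun : (fun p : Nat.Primes ↦ ∑' e, squarefreeProd (fun p ↦ u p * v p) ((p : ℕ) ^ e)) =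
      fun p : Nat.Primes ↦ 1 + u p / p := by
    funext p
    rw [squarefreeProd_prime_pow _ p.2, hv, div_eq_mul_inv]
  rw [hfun] at hprod
  refine ⟨hprod.multipliable, fun H ↦ ?_⟩
  rw [hprod.tprod_eq, sum_prod_primeFactors]
  have hfin : ∑ d ∈ Icc 1 H, squarefreeProd u d * ((H / d : ℕ) : ℝ) =
      ∑' d, squarefreeProd u d * ((H / d : ℕ) : ℝ) := by
    refine (tsum_eq_sum fun d hd ↦ ?_).symm
    rcases Nat.eq_zero_or_pos d with rfl | hd0
    · simp
    · rw [Nat.div_eq_of_lt (by simp at hd; omega)]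
      simp
  have hs1 : Summable fun d ↦ squarefreeProd u d * ((H / d : ℕ) : ℝ) := by
    refine summable_of_ne_finset_zero (s := Icc 1 H) fun d hd ↦ ?_
    rcases Nat.eq_zero_or_pos d with rfl | hd0
    · simp
    · rw [Nat.div_eq_of_lt (by simp at hd; omega)]
      simp
  rw [hfin, ← tsum_mul_left, ← hs1.tsum_sub (hnorm.of_norm.mul_left _), ← Real.norm_eq_abs]
  refine (tsum_of_norm_bounded (hsum.mul_left ((H : ℝ) ^ ε)).hasSum fun d ↦ ?_).trans ?_
  · rcases Nat.eq_zero_or_pos d with rfl | hd0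
    · simp
    · rw [squarefreeProd_mul_weight, hv, Real.norm_eq_abs,
        show squarefreeProd u d * ((H / d : ℕ) : ℝ) - H * (squarefreeProd u d * (d : ℝ)⁻¹) =
          squarefreeProd u d * (((H / d : ℕ) : ℝ) - H / d) by ring, abs_mul,
        mul_left_comm, hw]
      exact mul_le_mul_of_nonneg_left (abs_floor_div_sub_le hε hε1 hd0.ne') (abs_nonneg _)
  · rw [tsum_mul_left]
    exact mul_le_mul_of_nonneg_left htsum (by positivity)

theorem sum_inclusion_exclusion_of_symm {ι : Type*} (s : Finset ι) (c : ι → ι → ℝ)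
    (hc : ∀ x y, c x y = c y x) :
    ∑ x ∈ s, ∑ y ∈ s, ∑ z ∈ s, (1 - c x y) * (1 - c x z) * (1 - c y z) =
      (#s : ℝ) ^ 3 - 3 * (#s * ∑ x ∈ s, ∑ y ∈ s, c x y) + 3 * ∑ x ∈ s, (∑ y ∈ s, c x y) ^ 2 -
        ∑ x ∈ s, ∑ y ∈ s, c x y * ∑ z ∈ s, c x z * c y z := by
  have h1 : ∑ x ∈ s, ∑ y ∈ s, ∑ z ∈ s, c x y * c x z = ∑ x ∈ s, (∑ y ∈ s, c x y) ^ 2 :=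
    sum_congr rfl fun x _ ↦ by rw [sq, sum_mul_sum]
  have h2 : ∑ x ∈ s, ∑ y ∈ s, ∑ z ∈ s, c x y * c y z = ∑ x ∈ s, (∑ y ∈ s, c x y) ^ 2 := by
    rw [sum_comm, ← h1]
    exact sum_congr rfl fun x _ ↦ sum_congr rfl fun y _ ↦ by simp only [hc y x]
  have h3 : ∑ x ∈ s, ∑ y ∈ s, ∑ z ∈ s, c x z * c y z = ∑ x ∈ s, (∑ y ∈ s, c x y) ^ 2 := by
    rw [← h2]
    refine sum_congr rfl fun x _ ↦ ?_
    rw [sum_comm]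
    exact sum_congr rfl fun y _ ↦ sum_congr rfl fun z _ ↦ by rw [hc z y]
  have h4 : ∑ x ∈ s, ∑ y ∈ s, ∑ z ∈ s, c y z = #s * ∑ x ∈ s, ∑ y ∈ s, c x y := by simp
  have h5 : ∑ x ∈ s, ∑ y ∈ s, ∑ z ∈ s, c x y = #s * ∑ x ∈ s, ∑ y ∈ s, c x y := by
    simp [mul_sum]
  have h6 : ∑ x ∈ s, ∑ y ∈ s, ∑ z ∈ s, c x z = #s * ∑ x ∈ s, ∑ y ∈ s, c x y := by
    simp [mul_sum]
  have h7 : ∑ x ∈ s, ∑ y ∈ s, ∑ z ∈ s, c x y * (c x z * c y z) =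
      ∑ x ∈ s, ∑ y ∈ s, c x y * ∑ z ∈ s, c x z * c y z := by simp only [mul_sum]
  have h8 : ∑ x ∈ s, ∑ y ∈ s, ∑ z ∈ s, (1 : ℝ) = (#s : ℝ) ^ 3 := by simp; ring
  have h9 (x y z : ι) : (1 - c x y) * (1 - c x z) * (1 - c y z) =
      1 - c x y - c x z - c y z + c x y * c x z + c x y * c y z + c x z * c y z
        - c x y * (c x z * c y z) := by ring
  simp only [h9, sum_add_distrib, sum_sub_distrib, h1, h2, h3, h4, h5, h6, h7, h8]
  ring

/-- The indicator function of coprimality. -/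
noncomputable def coprimeInd (a b : ℕ) : ℝ := if a.Coprime b then 1 else 0

theorem coprimeInd_comm (a b : ℕ) : coprimeInd a b = coprimeInd b a := by
  simp only [coprimeInd, Nat.coprime_comm]

theorem coprimeInd_mul_left (a b c : ℕ) :
    coprimeInd a c * coprimeInd b c = coprimeInd (a * b) c := by
  simp only [coprimeInd, Nat.coprime_mul_iff_left, ite_and]
  split_ifs <;> simp

theorem coprimeInd_nonneg (a b : ℕ) : 0 ≤ coprimeInd a b := by
  unfold coprimeInd; split_ifs <;> norm_num

theorem coprimeInd_le_one (a b : ℕ) : coprimeInd a b ≤ 1 := by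
  unfold coprimeInd; split_ifs <;> norm_num

theorem N3_eq_sum (H : ℕ) : (N3 H : ℝ) = ∑ a ∈ Icc 1 H, ∑ b ∈ Icc 1 H, ∑ c ∈ Icc 1 H,
    (1 - coprimeInd a b) * (1 - coprimeInd a c) * (1 - coprimeInd b c) := by
  rw [N3, card_filter, Nat.cast_sum, sum_product]
  refine sum_congr rfl fun a _ ↦ ?_
  rw [sum_product]
  refine sum_congr rfl fun b _ ↦ sum_congr rfl fun c _ ↦ ?_
  simp only [coprimeInd, Nat.Coprime]
  split_ifs <;> simp_all

theorem prod_ite_dvd_eq_coprimeInd_mul (x : ℕ → ℝ) {a b : ℕ} (hb : b ≠ 0) :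
    ∏ p ∈ b.primeFactors, (if p ∣ a then 0 else x p) =
      coprimeInd a b * ∏ p ∈ b.primeFactors, x p := by
  unfold coprimeInd
  split_ifs with h
  · rw [one_mul]
    refine prod_congr rfl fun p hp ↦ if_neg fun hpa ↦ ?_
    exact Nat.not_coprime_of_dvd_of_dvd (Nat.prime_of_mem_primeFactors hp).one_lt hpa
      (Nat.dvd_of_mem_primeFactors hp) h
  · obtain ⟨p, hp, hpa, hpb⟩ := Nat.Prime.not_coprime_iff_dvd.1 h
    rw [zero_mul]
    exact prod_eq_zero (Nat.mem_primeFactors.2 ⟨hp, hpb, hb⟩) (if_pos hpa)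

theorem hasProd_primes_ite_dvd (w : ℕ → ℝ) {a : ℕ} (ha : a ≠ 0) :
    HasProd (fun p : Nat.Primes ↦ if (p : ℕ) ∣ a then w p else 1) (∏ p ∈ a.primeFactors, w p) := by
  have h := hasProd_prod_of_ne_finset_one (L := .unconditional _)
    (f := fun p : Nat.Primes ↦ if (p : ℕ) ∣ a then w p else 1)
    (s := a.primeFactors.subtype Nat.Prime) (fun p hp ↦ by
      rw [if_neg]
      intro hpa
      exact hp (Finset.mem_subtype.2 (Nat.mem_primeFactors.2 ⟨p.2, hpa, ha⟩)))
  convert h using 1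
  rw [← Finset.prod_subtype_of_mem (p := Nat.Prime) w
    (fun p hp ↦ Nat.prime_of_mem_primeFactors hp)]
  refine prod_congr rfl fun p hp ↦ (if_pos ?_).symm
  exact Nat.dvd_of_mem_primeFactors (Finset.mem_subtype.1 hp)

/-- The indicator function of the divisors of `a`. -/
noncomputable def divisorInd (a : ℕ) : ArithmeticFunction ℝ where
  toFun d := if d ∈ a.divisors then 1 else 0
  map_zero' := by simp

theorem divisorInd_apply (a d : ℕ) : divisorInd a d = if d ∈ a.divisors then 1 else 0 := rfl

theorem divisorInd_nonneg (a d : ℕ) : 0 ≤ divisorInd a d := by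
  rw [divisorInd_apply]; split_ifs <;> norm_num

theorem divisorInd_isMultiplicative {a : ℕ} (ha : a ≠ 0) : (divisorInd a).IsMultiplicative := by
  refine ⟨by simp [divisorInd_apply, ha], fun {m n} h ↦ ?_⟩
  have hdvd : m * n ∣ a ↔ m ∣ a ∧ n ∣ a :=
    ⟨fun h' ↦ ⟨dvd_of_mul_right_dvd h', dvd_of_mul_left_dvd h'⟩,
      fun h' ↦ h.mul_dvd_of_dvd_of_dvd h'.1 h'.2⟩
  simp only [divisorInd_apply, Nat.mem_divisors, ha, ne_eq, not_false_eq_true, and_true, hdvd,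
    ite_and]
  split_ifs <;> simp

theorem sum_divisorInd_le (a N : ℕ) : ∑ d ∈ Ioc 0 N, divisorInd a d ≤ #a.divisors := by
  simp only [divisorInd_apply]
  rw [sum_boole]
  exact_mod_cast card_le_card fun x hx ↦ (mem_filter.1 hx).2

/-- The arithmetic function `n ↦ n ^ (-(1 + ε))`. -/
noncomputable def powInd (ε : ℝ) : ArithmeticFunction ℝ where
  toFun d := if d = 0 then 0 else (d : ℝ) ^ (-(1 + ε))
  map_zero' := by simp

theorem powInd_apply (ε : ℝ) {d : ℕ} (hd : d ≠ 0) : powInd ε d = (d : ℝ)⁻¹ * (d : ℝ) ^ (-ε) := by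
  change (if d = 0 then 0 else (d : ℝ) ^ (-(1 + ε))) = _
  rw [if_neg hd, neg_add, Real.rpow_add (by positivity), Real.rpow_neg_one]

theorem powInd_nonneg (ε : ℝ) (d : ℕ) : 0 ≤ powInd ε d := by
  rcases eq_or_ne d 0 with rfl | hd
  · simp
  · rw [powInd_apply ε hd]; positivity

theorem powInd_isMultiplicative (ε : ℝ) : (powInd ε).IsMultiplicative := by
  rw [ArithmeticFunction.IsMultiplicative.iff_ne_zero]
  refine ⟨by simp [powInd_apply], fun {m n} hm hn _ ↦ ?_⟩
  rw [powInd_apply _ hm, powInd_apply _ hn, powInd_apply _ (mul_ne_zero hm hn), Nat.cast_mul,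
    Real.mul_rpow (by positivity) (by positivity)]
  ring

theorem powInd_succ_le {ε : ℝ} (hε : 0 < ε) {n : ℕ} (hn : n ≠ 0) :
    powInd ε (n + 1) ≤ (n : ℝ) ^ (-ε) / ε - ((n + 1 : ℕ) : ℝ) ^ (-ε) / ε := by
  rw [powInd_apply ε n.succ_ne_zero, ← sub_div, le_div_iff₀ hε]
  have hn0 : (0 : ℝ) < n := by positivity
  have hx : (0 : ℝ) < ((n + 1 : ℕ) : ℝ) := by positivity
  set x : ℝ := ((n + 1 : ℕ) : ℝ) with hxdef
  have hnx : (n : ℝ) = x - 1 := by rw [hxdef]; push_cast; ring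
  have hxp : 0 < x ^ (-ε) := by positivity
  have hlog : Real.log (n / x) ≤ -x⁻¹ := by
    have := Real.log_le_sub_one_of_pos (div_pos hn0 hx)
    rw [hnx, sub_div, div_self hx.ne', one_div] at this
    rw [hnx, sub_div, div_self hx.ne', one_div]
    linarith
  have h1 : 1 + ε * x⁻¹ ≤ ((n : ℝ) / x) ^ (-ε) := by
    rw [Real.rpow_def_of_pos (div_pos hn0 hx)]
    have := Real.add_one_le_exp (Real.log (n / x) * -ε)
    nlinarith
  have h2 : (n : ℝ) ^ (-ε) = ((n : ℝ) / x) ^ (-ε) * x ^ (-ε) := by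
    rw [← Real.mul_rpow (by positivity) hx.le, div_mul_cancel₀ _ hx.ne']
  rw [h2]
  nlinarith

theorem sum_powInd_le {ε : ℝ} (hε : 0 < ε) (N : ℕ) : ∑ d ∈ Ioc 0 N, powInd ε d ≤ 1 + 1 / ε := by
  rcases Nat.eq_zero_or_pos N with rfl | hN
  · simp only [Ioc_self, sum_empty]; positivity
  suffices h : ∑ d ∈ Ioc 0 N, powInd ε d ≤ 1 + 1 / ε - (N : ℝ) ^ (-ε) / ε by
    have : 0 ≤ (N : ℝ) ^ (-ε) / ε := by positivity
    linarith
  induction N, hN using Nat.le_induction with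
  | base => simp [powInd_apply]
  | succ n hn ih =>
    rw [sum_Ioc_succ_top n.zero_le]
    have := powInd_succ_le hε (n := n) (by omega)
    linarith

theorem sum_card_divisors_le (H : ℕ) :
    ∑ a ∈ Icc 1 H, (#a.divisors : ℝ) ≤ H * (1 + Real.log H) := by
  have h := ArithmeticFunction.sum_Ioc_sigma0_eq_sum_div H
  simp only [ArithmeticFunction.sigma_zero_apply] at h
  have h' : ∑ a ∈ Icc 1 H, (#a.divisors : ℝ) = ∑ n ∈ Icc 1 H, ((H / n : ℕ) : ℝ) := by
    exact_mod_cast h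
  rw [h']
  calc ∑ n ∈ Icc 1 H, ((H / n : ℕ) : ℝ) ≤ ∑ n ∈ Icc 1 H, (H : ℝ) * (n : ℝ)⁻¹ :=
        sum_le_sum fun n _ ↦ by rw [← div_eq_mul_inv]; exact Nat.cast_div_le
    _ = H * (harmonic H : ℝ) := by
        rw [← mul_sum, harmonic_eq_sum_Icc]; push_cast; rfl
    _ ≤ H * (1 + Real.log H) :=
        mul_le_mul_of_nonneg_left (harmonic_le_one_add_log H) (Nat.cast_nonneg H)

/-- The ratio `φ(a) / a` as a product over primes. -/
noncomputable def totientRatio (a : ℕ) : ℝ := ∏ p ∈ a.primeFactors, (1 + -(p : ℝ)⁻¹)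

theorem one_add_neg_inv_prime_mem {p : ℕ} (hp : p.Prime) :
    0 ≤ 1 + -(p : ℝ)⁻¹ ∧ 1 + -(p : ℝ)⁻¹ ≤ 1 := by
  have h1 : (p : ℝ)⁻¹ ≤ 1 := inv_le_one_of_one_le₀ (by exact_mod_cast hp.one_lt.le)
  have h2 : 0 ≤ (p : ℝ)⁻¹ := by positivity
  constructor <;> linarith

theorem totientRatio_nonneg (a : ℕ) : 0 ≤ totientRatio a :=
  prod_nonneg fun _ hp ↦ (one_add_neg_inv_prime_mem (Nat.prime_of_mem_primeFactors hp)).1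

theorem totientRatio_le_one (a : ℕ) : totientRatio a ≤ 1 :=
  prod_le_one (fun _ hp ↦ (one_add_neg_inv_prime_mem (Nat.prime_of_mem_primeFactors hp)).1)
    fun _ hp ↦ (one_add_neg_inv_prime_mem (Nat.prime_of_mem_primeFactors hp)).2

theorem coprimeInd_mul_totientRatio (a b : ℕ) :
    coprimeInd a b * totientRatio (a * b) =
      totientRatio a * (coprimeInd a b * totientRatio b) := by
  unfold coprimeInd
  split_ifs with h
  · rw [one_mul, one_mul, totientRatio, h.primeFactors_mul, prod_union h.disjoint_primeFactors]
    rfl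
  · simp

theorem abs_sum_coprimeInd_sub_le {a : ℕ} (ha : a ≠ 0) (H : ℕ) :
    |∑ b ∈ Icc 1 H, coprimeInd a b - H * totientRatio a| ≤ #a.divisors := by
  have h := (mean_value_prod_primeFactors (u := fun p ↦ if p ∣ a then -1 else 0) (ε := 0)
    (F := divisorInd a) (G := 1) (A := #a.divisors) (B := 1) le_rfl zero_le_one
    (divisorInd_isMultiplicative ha) ArithmeticFunction.isMultiplicative_one
    (divisorInd_nonneg a) (fun n ↦ by rw [ArithmeticFunction.one_apply]; split_ifs <;> norm_num)
    (fun p hp ↦ by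
      simp only [divisorInd_apply, ArithmeticFunction.one_apply, hp.ne_one, Nat.mem_divisors]
      split_ifs <;> simp_all)
    (sum_divisorInd_le a) (fun N ↦ by
      simp only [ArithmeticFunction.one_apply, sum_ite_eq']
      split_ifs <;> norm_num)).2 H
  have htp : ∏' p : Nat.Primes, (1 + (if (p : ℕ) ∣ a then (-1 : ℝ) else 0) / (p : ℕ)) =
      totientRatio a := by
    rw [totientRatio, ← (hasProd_primes_ite_dvd (fun p ↦ 1 + -(p : ℝ)⁻¹) ha).tprod_eq]
    refine tprod_congr fun p ↦ ?_
    split_ifs <;> simp [neg_div]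
  have hs : ∑ b ∈ Icc 1 H, ∏ p ∈ b.primeFactors, (1 + if p ∣ a then (-1 : ℝ) else 0) =
      ∑ b ∈ Icc 1 H, coprimeInd a b := by
    refine sum_congr rfl fun b hb ↦ ?_
    have := prod_ite_dvd_eq_coprimeInd_mul (fun _ ↦ 1) (a := a) (b := b)
      (by simp at hb; omega)
    rw [prod_const_one, mul_one] at this
    rw [← this]
    refine prod_congr rfl fun p _ ↦ ?_
    split_ifs <;> norm_num
  rw [htp, hs] at h
  simpa using h

theorem mean_value_totientRatio {ε : ℝ} (hε : 0 < ε) (hε1 : ε ≤ 1) :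
    Multipliable (fun p : Nat.Primes ↦ 1 + -((p : ℕ) : ℝ)⁻¹ / (p : ℕ)) ∧ ∀ H : ℕ,
      |∑ n ∈ Icc 1 H, totientRatio n
        - H * ∏' p : Nat.Primes, (1 + -((p : ℕ) : ℝ)⁻¹ / (p : ℕ))| ≤
        (H : ℝ) ^ ε * (1 + 1 / ε) := by
  have h := mean_value_prod_primeFactors (u := fun p ↦ -(p : ℝ)⁻¹) (ε := ε)
    (F := powInd ε) (G := 1) (A := 1 + 1 / ε) (B := 1) hε.le hε1
    (powInd_isMultiplicative ε) ArithmeticFunction.isMultiplicative_one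
    (powInd_nonneg ε) (fun n ↦ by rw [ArithmeticFunction.one_apply]; split_ifs <;> norm_num)
    (fun p hp ↦ by
      simp [powInd_apply ε hp.ne_zero, hp.ne_one])
    (sum_powInd_le hε) (fun N ↦ by
      simp only [ArithmeticFunction.one_apply, sum_ite_eq']
      split_ifs <;> norm_num)
  rw [mul_one] at h
  exact h

theorem mean_value_of_abs_le_two_div {u : ℕ → ℝ} (hu : ∀ p, p.Prime → |u p| ≤ 2 * (p : ℝ)⁻¹)
    {ε : ℝ} (hε : 0 < ε) (hε1 : ε ≤ 1) :
    Multipliable (fun p : Nat.Primes ↦ 1 + u p / p) ∧ ∀ H : ℕ,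
      |∑ n ∈ Icc 1 H, ∏ p ∈ n.primeFactors, (1 + u p) - H * ∏' p : Nat.Primes, (1 + u p / p)| ≤
        (H : ℝ) ^ ε * ((1 + 1 / ε) * (1 + 1 / ε)) :=
  mean_value_prod_primeFactors hε.le hε1 (powInd_isMultiplicative ε) (powInd_isMultiplicative ε)
    (powInd_nonneg ε) (powInd_nonneg ε)
    (fun p hp ↦ by
      rw [powInd_apply ε hp.ne_zero]
      have : 0 ≤ (p : ℝ) ^ (-ε) := by positivity
      nlinarith [hu p hp])
    (sum_powInd_le hε) (sum_powInd_le hε)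

theorem abs_sum_coprimeInd_mul_totientRatio_sub_le {a : ℕ} (ha : a ≠ 0) {ε : ℝ} (hε : 0 < ε)
    (hε1 : ε ≤ 1) (H : ℕ) :
    |∑ b ∈ Icc 1 H, coprimeInd a b * totientRatio b -
      H * ((∏' p : Nat.Primes, (1 + -((p : ℕ) : ℝ)⁻¹ / (p : ℕ))) *
        ∏ p ∈ a.primeFactors, (p / (p + 1) : ℝ))| ≤
      (H : ℝ) ^ ε * (#a.divisors * (1 + 1 / ε)) := by
  have h := (mean_value_prod_primeFactors (u := fun p ↦ if p ∣ a then -1 else -(p : ℝ)⁻¹) (ε := ε)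
    hε.le hε1 (divisorInd_isMultiplicative ha) (powInd_isMultiplicative ε)
    (divisorInd_nonneg a) (powInd_nonneg ε)
    (fun p hp ↦ by
      have h1 : (p : ℝ) ^ (-ε) ≤ 1 :=
        Real.rpow_le_one_of_one_le_of_nonpos (by exact_mod_cast hp.one_lt.le) (by linarith)
      have h2 := powInd_nonneg ε p
      by_cases hpa : p ∣ a
      · simp only [divisorInd_apply, Nat.mem_divisors, hpa, ha, ne_eq, not_false_eq_true,
          and_self, if_true, abs_neg, abs_one, one_mul]
        linarith
      · simp [divisorInd_apply, hpa, powInd_apply ε hp.ne_zero])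
    (sum_divisorInd_le a) (sum_powInd_le hε)).2 H
  have htp : ∏' p : Nat.Primes, (1 + (if (p : ℕ) ∣ a then (-1 : ℝ) else -((p : ℕ) : ℝ)⁻¹) / (p : ℕ))
      = (∏' p : Nat.Primes, (1 + -((p : ℕ) : ℝ)⁻¹ / (p : ℕ))) *
        ∏ p ∈ a.primeFactors, (p / (p + 1) : ℝ) := by
    have hw := hasProd_primes_ite_dvd (fun p ↦ (p / (p + 1) : ℝ)) ha
    rw [← hw.tprod_eq, ← (mean_value_totientRatio hε hε1).1.tprod_mul hw.multipliable]
    refine tprod_congr fun p ↦ ?_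
    have hp : ((p : ℕ) : ℝ) ≠ 0 := by exact_mod_cast p.2.ne_zero
    have hp' : ((p : ℕ) : ℝ) + 1 ≠ 0 := by positivity
    split_ifs
    · field_simp
      ring
    · simp
  have hs : ∑ b ∈ Icc 1 H, ∏ p ∈ b.primeFactors, (1 + if p ∣ a then (-1 : ℝ) else -(p : ℝ)⁻¹) =
      ∑ b ∈ Icc 1 H, coprimeInd a b * totientRatio b := by
    refine sum_congr rfl fun b hb ↦ ?_
    rw [totientRatio, ← prod_ite_dvd_eq_coprimeInd_mul _ (by simp at hb; omega)]
    refine prod_congr rfl fun p _ ↦ ?_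
    split_ifs <;> norm_num
  rwa [htp, hs] at h

theorem tprod_primes_one_sub_inv_sq :
    ∏' p : Nat.Primes, (1 + -((p : ℕ) : ℝ)⁻¹ / (p : ℕ)) = 1 / (Real.pi ^ 2 / 6) := by
  have h1 := (mean_value_totientRatio one_pos le_rfl).1.hasProd.map Complex.ofRealHom
    Complex.continuous_ofReal
  have h2 := riemannZeta_eulerProduct_hasProd (s := 2) (by norm_num)
  have h3 := h1.mul h2
  have h4 : ((Complex.ofRealHom ∘ fun p : Nat.Primes ↦ 1 + -((p : ℕ) : ℝ)⁻¹ / (p : ℕ)) *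
      fun p : Nat.Primes ↦ (1 - ((p : ℕ) : ℂ) ^ (-2 : ℂ))⁻¹) = 1 := by
    funext p
    have hp : (2 : ℝ) ≤ (p : ℕ) := by exact_mod_cast p.2.two_le
    have hne : (1 : ℝ) - (((p : ℕ) : ℝ) ^ 2)⁻¹ ≠ 0 := by
      have : (((p : ℕ) : ℝ) ^ 2)⁻¹ < 1 := inv_lt_one_of_one_lt₀ (by nlinarith)
      linarith
    have e1 : (1 - ((p : ℕ) : ℂ) ^ (-2 : ℂ)) = ((1 - (((p : ℕ) : ℝ) ^ 2)⁻¹ : ℝ) : ℂ) := by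
      rw [Complex.cpow_neg, show (2 : ℂ) = ((2 : ℕ) : ℂ) by norm_num, Complex.cpow_natCast]
      push_cast
      rfl
    have e2 : (1 + -((p : ℕ) : ℝ)⁻¹ / (p : ℕ)) = 1 - (((p : ℕ) : ℝ) ^ 2)⁻¹ := by
      rw [neg_div, div_eq_mul_inv, sq, mul_inv]
      ring
    simp only [Pi.mul_apply, Function.comp_apply, e2, Pi.one_apply]
    rw [e1]
    exact mul_inv_cancel₀ (Complex.ofReal_ne_zero.2 hne)
  rw [show (fun p : Nat.Primes ↦ (Complex.ofRealHom ∘ fun p : Nat.Primes ↦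
    1 + -((p : ℕ) : ℝ)⁻¹ / (p : ℕ)) p * (1 - ((p : ℕ) : ℂ) ^ (-2 : ℂ))⁻¹) = 1 from h4] at h3
  have h5 := h3.unique hasProd_one
  rw [riemannZeta_two] at h5
  rw [eq_div_iff (by positivity)]
  rw [Complex.ofRealHom_eq_coe] at h5
  exact_mod_cast h5

theorem abs_sum_sub_le_of_abs_sub_le {ι : Type*} (s : Finset ι) {f g e : ι → ℝ} {x B M : ℝ}
    (h : ∀ i ∈ s, |f i - g i| ≤ e i) (he : ∑ i ∈ s, e i ≤ B) (hg : |∑ i ∈ s, g i - x| ≤ M) :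
    |∑ i ∈ s, f i - x| ≤ B + M := by
  have h1 : |∑ i ∈ s, f i - ∑ i ∈ s, g i| ≤ B := by
    rw [← sum_sub_distrib]
    exact (abs_sum_le_sum_abs _ _).trans ((sum_le_sum h).trans he)
  exact (abs_sub_le _ _ _).trans (add_le_add h1 hg)

theorem ne_zero_of_mem_Icc_one {a H : ℕ} (ha : a ∈ Icc 1 H) : a ≠ 0 := by
  simp at ha; omega

theorem abs_sum_coprime_pairs_sub_le (H : ℕ) {ε : ℝ} (hε : 0 < ε) (hε1 : ε ≤ 1) :
    |∑ a ∈ Icc 1 H, ∑ b ∈ Icc 1 H, coprimeInd a b -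
      H * (H * ∏' p : Nat.Primes, (1 + -((p : ℕ) : ℝ)⁻¹ / (p : ℕ)))| ≤
      H * (1 + Real.log H) + H * ((H : ℝ) ^ ε * (1 + 1 / ε)) := by
  refine abs_sum_sub_le_of_abs_sub_le _ (g := fun a ↦ H * totientRatio a)
    (fun a ha ↦ abs_sum_coprimeInd_sub_le (ne_zero_of_mem_Icc_one ha) H)
    (sum_card_divisors_le H) ?_
  rw [← mul_sum, ← mul_sub, abs_mul, abs_of_nonneg (Nat.cast_nonneg H)]
  exact mul_le_mul_of_nonneg_left ((mean_value_totientRatio hε hε1).2 H) (Nat.cast_nonneg H)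

theorem abs_sum_sq_coprime_sub_le (H : ℕ) {ε : ℝ} (hε : 0 < ε) (hε1 : ε ≤ 1) :
    |∑ a ∈ Icc 1 H, (∑ b ∈ Icc 1 H, coprimeInd a b) ^ 2 -
      H ^ 2 * (H * ∏' p : Nat.Primes, (1 - (2 * (p : ℕ) - 1) / ((p : ℕ) : ℝ) ^ 3))| ≤
      2 * H * (H * (1 + Real.log H)) +
        H ^ 2 * ((H : ℝ) ^ ε * ((1 + 1 / ε) * (1 + 1 / ε))) := by
  have hH : (0 : ℝ) ≤ H := Nat.cast_nonneg H
  have hmean := (mean_value_of_abs_le_two_div (u := fun p ↦ (1 + -(p : ℝ)⁻¹) ^ 2 - 1)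
    (fun p hp ↦ by
      have h1 : (p : ℝ)⁻¹ ≤ 1 := inv_le_one_of_one_le₀ (by exact_mod_cast hp.one_lt.le)
      have h2 : 0 ≤ (p : ℝ)⁻¹ := by positivity
      rw [abs_le]
      constructor <;> nlinarith) hε hε1).2 H
  have hprod : ∏' p : Nat.Primes, (1 + ((1 + -((p : ℕ) : ℝ)⁻¹) ^ 2 - 1) / (p : ℕ)) =
      ∏' p : Nat.Primes, (1 - (2 * (p : ℕ) - 1) / ((p : ℕ) : ℝ) ^ 3) := by
    refine tprod_congr fun p ↦ ?_
    have hp : ((p : ℕ) : ℝ) ≠ 0 := by exact_mod_cast p.2.ne_zero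
    field_simp
    ring
  have hsum : ∑ a ∈ Icc 1 H, ∏ p ∈ a.primeFactors, (1 + ((1 + -(p : ℝ)⁻¹) ^ 2 - 1)) =
      ∑ a ∈ Icc 1 H, totientRatio a ^ 2 := by
    refine sum_congr rfl fun a _ ↦ ?_
    rw [totientRatio, ← prod_pow]
    exact prod_congr rfl fun p _ ↦ by ring
  rw [hprod, hsum] at hmean
  refine abs_sum_sub_le_of_abs_sub_le _ (g := fun a ↦ H ^ 2 * totientRatio a ^ 2)
    (e := fun a ↦ 2 * H * #a.divisors) (fun a ha ↦ ?_) ?_ ?_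
  · have h1 := abs_sum_coprimeInd_sub_le (ne_zero_of_mem_Icc_one ha) H
    have h2 : ∑ b ∈ Icc 1 H, coprimeInd a b ≤ H :=
      (sum_le_sum fun b _ ↦ coprimeInd_le_one a b).trans (by simp)
    have h3 : 0 ≤ ∑ b ∈ Icc 1 H, coprimeInd a b := sum_nonneg fun b _ ↦ coprimeInd_nonneg a b
    have h4 := mul_le_mul_of_nonneg_left (totientRatio_le_one a) hH
    have h5 := mul_nonneg hH (totientRatio_nonneg a)
    rw [← mul_pow, sq_sub_sq, abs_mul, abs_of_nonneg (add_nonneg h3 h5)]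
    exact mul_le_mul (by linarith) h1 (abs_nonneg _) (by positivity)
  · rw [← mul_sum]
    exact mul_le_mul_of_nonneg_left (sum_card_divisors_le H) (by positivity)
  · rw [← mul_sum, ← mul_sub, abs_mul, abs_of_nonneg (by positivity)]
    exact mul_le_mul_of_nonneg_left hmean (by positivity)

theorem abs_sum_totientRatio_mul_sub_le (H : ℕ) {ε : ℝ} (hε : 0 < ε) (hε1 : ε ≤ 1) :
    |∑ a ∈ Icc 1 H, totientRatio a * ((∏' p : Nat.Primes, (1 + -((p : ℕ) : ℝ)⁻¹ / (p : ℕ))) *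
        ∏ p ∈ a.primeFactors, (p / (p + 1) : ℝ)) -
      H * ∏' p : Nat.Primes, (1 - (3 * (p : ℕ) - 2) / ((p : ℕ) : ℝ) ^ 3)| ≤
        (H : ℝ) ^ ε * ((1 + 1 / ε) * (1 + 1 / ε)) := by
  have hmean := mean_value_of_abs_le_two_div (u := fun p ↦ -2 / (p + 1))
    (fun p hp ↦ by
      have hp0 : (0 : ℝ) < p := by exact_mod_cast hp.pos
      rw [abs_div, abs_neg, abs_two, abs_of_pos (by positivity), ← div_eq_mul_inv]
      gcongr
      linarith) hε hε1
  have hprod : ∏' p : Nat.Primes, (1 - (3 * (p : ℕ) - 2) / ((p : ℕ) : ℝ) ^ 3) =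
      (∏' p : Nat.Primes, (1 + -((p : ℕ) : ℝ)⁻¹ / (p : ℕ))) *
        ∏' p : Nat.Primes, (1 + (-2 / (((p : ℕ) : ℝ) + 1)) / (p : ℕ)) := by
    rw [← (mean_value_totientRatio hε hε1).1.tprod_mul hmean.1]
    refine tprod_congr fun p ↦ ?_
    have hp : ((p : ℕ) : ℝ) ≠ 0 := by exact_mod_cast p.2.ne_zero
    have hp' : ((p : ℕ) : ℝ) + 1 ≠ 0 := by positivity
    field_simp
    ring
  have hsum : ∑ a ∈ Icc 1 H, totientRatio a *
        ((∏' p : Nat.Primes, (1 + -((p : ℕ) : ℝ)⁻¹ / (p : ℕ))) *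
          ∏ p ∈ a.primeFactors, (p / (p + 1) : ℝ)) =
      (∏' p : Nat.Primes, (1 + -((p : ℕ) : ℝ)⁻¹ / (p : ℕ))) *
        ∑ a ∈ Icc 1 H, ∏ p ∈ a.primeFactors, (1 + -2 / ((p : ℝ) + 1)) := by
    rw [mul_sum]
    refine sum_congr rfl fun a _ ↦ ?_
    rw [mul_left_comm, totientRatio, ← prod_mul_distrib]
    congr 1
    refine prod_congr rfl fun p hp ↦ ?_
    have hp0 : (p : ℝ) ≠ 0 := by exact_mod_cast (Nat.prime_of_mem_primeFactors hp).ne_zero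
    have hp' : (p : ℝ) + 1 ≠ 0 := by positivity
    field_simp
    ring
  rw [hprod, hsum, mul_left_comm, ← mul_sub, abs_mul]
  have hP : |∏' p : Nat.Primes, (1 + -((p : ℕ) : ℝ)⁻¹ / (p : ℕ))| ≤ 1 := by
    rw [tprod_primes_one_sub_inv_sq, abs_of_nonneg (by positivity), div_le_one (by positivity)]
    nlinarith [Real.pi_gt_three]
  exact (mul_le_of_le_one_left (abs_nonneg _) hP).trans (hmean.2 H)

theorem abs_sum_pairwise_coprime_sub_le (H : ℕ) {ε : ℝ} (hε : 0 < ε) (hε1 : ε ≤ 1) :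
    |∑ a ∈ Icc 1 H, ∑ b ∈ Icc 1 H, coprimeInd a b *
        ∑ c ∈ Icc 1 H, coprimeInd a c * coprimeInd b c -
      H * (H * (H * ∏' p : Nat.Primes, (1 - (3 * (p : ℕ) - 2) / ((p : ℕ) : ℝ) ^ 3)))| ≤
      (H * (1 + Real.log H)) ^ 2 +
        H * (H * (1 + Real.log H) * ((H : ℝ) ^ ε * (1 + 1 / ε)) +
          H * ((H : ℝ) ^ ε * ((1 + 1 / ε) * (1 + 1 / ε)))) := by
  have hH : (0 : ℝ) ≤ H := Nat.cast_nonneg H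
  have hcard : (0 : ℝ) ≤ ∑ a ∈ Icc 1 H, (#a.divisors : ℝ) :=
    sum_nonneg fun a _ ↦ Nat.cast_nonneg _
  refine abs_sum_sub_le_of_abs_sub_le _
    (g := fun a ↦ H * (totientRatio a * ∑ b ∈ Icc 1 H, coprimeInd a b * totientRatio b))
    (e := fun a ↦ #a.divisors * ∑ b ∈ Icc 1 H, (#b.divisors : ℝ)) (fun a ha ↦ ?_) ?_ ?_
  · rw [mul_sum, mul_sum, ← sum_sub_distrib, mul_sum]
    refine (abs_sum_le_sum_abs _ _).trans (sum_le_sum fun b hb ↦ ?_)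
    rw [← coprimeInd_mul_totientRatio, mul_left_comm, ← mul_sub, abs_mul,
      abs_of_nonneg (coprimeInd_nonneg a b)]
    simp only [coprimeInd_mul_left]
    by_cases h : a.Coprime b
    · refine (mul_le_of_le_one_left (abs_nonneg _) (coprimeInd_le_one a b)).trans ?_
      rw [← Nat.cast_mul, ← h.card_divisors_mul]
      exact abs_sum_coprimeInd_sub_le
        (mul_ne_zero (ne_zero_of_mem_Icc_one ha) (ne_zero_of_mem_Icc_one hb)) H
    · rw [coprimeInd, if_neg h, zero_mul]
      positivity
  · rw [← sum_mul, ← sq]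
    exact pow_le_pow_left₀ hcard (sum_card_divisors_le H) 2
  · rw [← mul_sum, ← mul_sub, abs_mul, abs_of_nonneg hH]
    refine mul_le_mul_of_nonneg_left ?_ hH
    refine abs_sum_sub_le_of_abs_sub_le _
      (g := fun a ↦ H * (totientRatio a *
        ((∏' p : Nat.Primes, (1 + -((p : ℕ) : ℝ)⁻¹ / (p : ℕ))) *
          ∏ p ∈ a.primeFactors, (p / (p + 1) : ℝ))))
      (e := fun a ↦ #a.divisors * ((H : ℝ) ^ ε * (1 + 1 / ε))) (fun a ha ↦ ?_) ?_ ?_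
    · rw [mul_left_comm (H : ℝ) (totientRatio a), ← mul_sub, abs_mul,
        abs_of_nonneg (totientRatio_nonneg a)]
      refine (mul_le_of_le_one_left (abs_nonneg _) (totientRatio_le_one a)).trans ?_
      rw [mul_left_comm (#a.divisors : ℝ)]
      exact abs_sum_coprimeInd_mul_totientRatio_sub_le (ne_zero_of_mem_Icc_one ha) hε hε1 H
    · rw [← sum_mul]
      exact mul_le_mul_of_nonneg_right (sum_card_divisors_le H) (by positivity)
    · rw [← mul_sum, ← mul_sub, abs_mul, abs_of_nonneg hH]
      exact mul_le_mul_of_nonneg_left (abs_sum_totientRatio_mul_sub_le H hε hε1) hH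

theorem abs_inclusion_exclusion_sub_le {h L E S₁ S₂ S₃ P₁ P₂ P₃ : ℝ} (hh : 0 ≤ h)
    (hL : 0.69 ≤ L) (hE0 : 0 ≤ E) (hE : E ≤ 3)
    (h1 : |S₁ - h * (h * P₁)| ≤ h * (1 + L) + h * (E * (2 + L)))
    (h2 : |S₂ - h ^ 2 * (h * P₂)| ≤
      2 * h * (h * (1 + L)) + h ^ 2 * (E * ((2 + L) * (2 + L))))
    (h3 : |S₃ - h * (h * (h * P₃))| ≤
      (h * (1 + L)) ^ 2 + h * (h * (1 + L) * (E * (2 + L)) + h * (E * ((2 + L) * (2 + L))))) :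
    |h ^ 3 - 3 * (h * S₁) + 3 * S₂ - S₃ - (1 - 3 * P₁ + 3 * P₂ - P₃) * h ^ 3| ≤
      544 * h ^ 2 * L ^ 2 := by
  have hL0 : 0 ≤ L := by linarith
  have hK1 : 1 + L ≤ 4 * L := by linarith
  have hK2 : 2 + L ≤ 4 * L := by linarith
  have hK : 4 * L ≤ (4 * L) ^ 2 := by nlinarith
  have b1 : h * (1 + L) + h * (E * (2 + L)) ≤ 4 * h * (4 * L) ^ 2 := by
    calc h * (1 + L) + h * (E * (2 + L)) ≤ h * (4 * L) + h * (3 * (4 * L)) := by gcongr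
      _ = 4 * h * (4 * L) := by ring
      _ ≤ 4 * h * (4 * L) ^ 2 := by gcongr
  have b2 : 2 * h * (h * (1 + L)) + h ^ 2 * (E * ((2 + L) * (2 + L))) ≤
      5 * h ^ 2 * (4 * L) ^ 2 := by
    calc 2 * h * (h * (1 + L)) + h ^ 2 * (E * ((2 + L) * (2 + L))) ≤
        2 * h * (h * (4 * L)) + h ^ 2 * (3 * ((4 * L) * (4 * L))) := by gcongr
      _ ≤ 2 * h * (h * (4 * L) ^ 2) + h ^ 2 * (3 * ((4 * L) * (4 * L))) := by gcongr
      _ = 5 * h ^ 2 * (4 * L) ^ 2 := by ring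
  have b3 : (h * (1 + L)) ^ 2 + h * (h * (1 + L) * (E * (2 + L)) +
      h * (E * ((2 + L) * (2 + L)))) ≤ 7 * h ^ 2 * (4 * L) ^ 2 := by
    calc (h * (1 + L)) ^ 2 + h * (h * (1 + L) * (E * (2 + L)) + h * (E * ((2 + L) * (2 + L)))) ≤
        (h * (4 * L)) ^ 2 + h * (h * (4 * L) * (3 * (4 * L)) +
          h * (3 * ((4 * L) * (4 * L)))) := by gcongr
      _ = 7 * h ^ 2 * (4 * L) ^ 2 := by ring
  have e1 : 3 * h * (4 * h * (4 * L) ^ 2) = 192 * (h ^ 2 * L ^ 2) := by ring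
  have e2 : 5 * h ^ 2 * (4 * L) ^ 2 = 80 * (h ^ 2 * L ^ 2) := by ring
  have e3 : 7 * h ^ 2 * (4 * L) ^ 2 = 112 * (h ^ 2 * L ^ 2) := by ring
  have c1 : |3 * h * (S₁ - h * (h * P₁))| ≤ 192 * (h ^ 2 * L ^ 2) := by
    rw [abs_mul, abs_of_nonneg (by positivity : 0 ≤ 3 * h), ← e1]
    exact mul_le_mul_of_nonneg_left (h1.trans b1) (by positivity)
  have c2 := abs_le.1 ((h2.trans b2).trans_eq e2)
  have c3 := abs_le.1 ((h3.trans b3).trans_eq e3)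
  have c1' := abs_le.1 c1
  have key : h ^ 3 - 3 * (h * S₁) + 3 * S₂ - S₃ - (1 - 3 * P₁ + 3 * P₂ - P₃) * h ^ 3 =
      -(3 * h * (S₁ - h * (h * P₁))) + 3 * (S₂ - h ^ 2 * (h * P₂)) -
        (S₃ - h * (h * (h * P₃))) := by ring
  rw [key, abs_le, mul_assoc]
  constructor <;> linarith [c1'.1, c1'.2, c2.1, c2.2, c3.1, c3.2]

theorem pairwise_non_coprime_triples_asymptotic :
    ∃ C : ℝ, 0 < C ∧ ∀ H : ℕ, 2 ≤ H →
      |(N3 H : ℝ) -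
        (1 - 3 / (Real.pi ^ 2 / 6)
          + 3 * ∏' p : Nat.Primes, (1 - (2 * (p : ℕ) - 1) / ((p : ℕ) : ℝ) ^ 3)
          - ∏' p : Nat.Primes, (1 - (3 * (p : ℕ) - 2) / ((p : ℕ) : ℝ) ^ 3)) * (H : ℝ) ^ 3|
      ≤ C * (H : ℝ) ^ 2 * (Real.log H) ^ 2 := by
  refine ⟨544, by norm_num, fun H hH ↦ ?_⟩
  have hH0 : (0 : ℝ) < H := by positivity
  have hL : 0.69 ≤ Real.log H := by
    have := Real.log_le_log two_pos (by exact_mod_cast hH : (2 : ℝ) ≤ H)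
    linarith [Real.log_two_gt_d9]
  set ε : ℝ := 1 / (1 + Real.log H) with hεdef
  have hε : 0 < ε := by positivity
  have hε1 : ε ≤ 1 := by
    rw [hεdef, div_le_one (by linarith)]
    linarith
  have hZ : 1 + 1 / ε = 2 + Real.log H := by
    rw [hεdef, one_div_one_div]
    ring
  have hE : (H : ℝ) ^ ε ≤ 3 := by
    rw [Real.rpow_def_of_pos hH0]
    refine (Real.exp_le_exp.2 (?_ : _ ≤ (1 : ℝ))).trans (by linarith [Real.exp_one_lt_d9])
    rw [hεdef, mul_one_div, div_le_one (by linarith)]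
    linarith
  have h1 := abs_sum_coprime_pairs_sub_le H hε hε1
  have h2 := abs_sum_sq_coprime_sub_le H hε hε1
  have h3 := abs_sum_pairwise_coprime_sub_le H hε hε1
  rw [tprod_primes_one_sub_inv_sq, hZ] at h1
  rw [hZ] at h2 h3
  rw [N3_eq_sum, sum_inclusion_exclusion_of_symm _ _ coprimeInd_comm, Nat.card_Icc,
    Nat.add_sub_cancel]
  rw [← mul_one_div 3 (Real.pi ^ 2 / 6)]
  exact abs_inclusion_exclusion_sub_le hH0.le hL (by positivity) hE h1 h2 h3
end

section
/- The constant $\rho = 1 - 3/\zeta(2) + 3\prod_{p\ \mathrm{prime}}\left(1 - \frac{2p-1}{p^3}\right) - \prod_{p\ \mathrm{prime}}\left(1 - \frac{3p-2}{p^3}\right)$ satisfies $0.17 < \rho < 0.18$. -/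
open Finset

section PrimeProducts

variable {f : ℕ → ℝ} {k : ℕ}

theorem one_sub_one_div_sq_nonneg {n : ℕ} (hn : 2 ≤ n) : 0 ≤ 1 - 1 / (n : ℝ) ^ 2 := by
  have h : (1 : ℝ) ≤ (n : ℝ) ^ 2 := one_le_pow₀ (by exact_mod_cast (by omega : 1 ≤ n))
  rw [sub_nonneg, div_le_one (by positivity)]
  exact h

theorem multipliable_mulIndicator_primes
    (hl : ∀ n : ℕ, 2 ≤ n → (1 - 1 / (n : ℝ) ^ 2) ^ k ≤ f n) (hu : ∀ n : ℕ, 2 ≤ n → f n ≤ 1) :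
    Multipliable ({p : ℕ | p.Prime}.mulIndicator f) := by
  have hs : Summable fun n : ℕ ↦ ({p : ℕ | p.Prime}.mulIndicator f n - 1) := by
    refine Summable.of_norm_bounded
      ((Real.summable_one_div_nat_pow.2 one_lt_two).mul_left (k : ℝ)) fun n ↦ ?_
    by_cases hp : n.Prime
    · have hn := hp.two_le
      have h := one_add_mul_le_pow (a := -(1 / (n : ℝ) ^ 2))
        (by linarith [one_sub_one_div_sq_nonneg hn]) k
      have h1 := hl n hn
      have h2 := hu n hn
      rw [Set.mulIndicator_of_mem (by exact hp), Real.norm_eq_abs, abs_le]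
      rw [← sub_eq_add_neg] at h
      constructor <;> linarith
    · rw [Set.mulIndicator_of_notMem (by exact hp), sub_self, norm_zero]
      positivity
  simpa using Real.multipliable_one_add_of_summable hs

theorem tendsto_prod_primes_range
    (hl : ∀ n : ℕ, 2 ≤ n → (1 - 1 / (n : ℝ) ^ 2) ^ k ≤ f n) (hu : ∀ n : ℕ, 2 ≤ n → f n ≤ 1) :
    Filter.Tendsto (fun N ↦ ∏ n ∈ range N, if n.Prime then f n else 1) Filter.atTop
      (nhds (∏' p : Nat.Primes, f p)) := by
  have h := (multipliable_mulIndicator_primes hl hu).hasProd.tendsto_prod_nat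
  rw [← _root_.tprod_subtype] at h
  simp only [Set.mulIndicator_apply, Set.mem_ofPred_eq] at h
  exact h

theorem prod_primes_range_nonneg
    (hl : ∀ n : ℕ, 2 ≤ n → (1 - 1 / (n : ℝ) ^ 2) ^ k ≤ f n) (N : ℕ) :
    0 ≤ ∏ n ∈ range N, if n.Prime then f n else 1 := by
  refine prod_nonneg fun n _ ↦ ?_
  split_ifs with hp
  · exact (pow_nonneg (one_sub_one_div_sq_nonneg hp.two_le) k).trans (hl n hp.two_le)
  · exact zero_le_one

theorem tprod_primes_le_prod_range
    (hl : ∀ n : ℕ, 2 ≤ n → (1 - 1 / (n : ℝ) ^ 2) ^ k ≤ f n) (hu : ∀ n : ℕ, 2 ≤ n → f n ≤ 1) (M : ℕ) :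
    ∏' p : Nat.Primes, f p ≤ ∏ n ∈ range M, if n.Prime then f n else 1 := by
  refine Antitone.le_of_tendsto (antitone_nat_of_succ_le fun N ↦ ?_)
    (tendsto_prod_primes_range hl hu) M
  rw [prod_range_succ]
  refine mul_le_of_le_one_right (prod_primes_range_nonneg hl N) ?_
  split_ifs with hp
  · exact hu N hp.two_le
  · exact le_rfl

theorem prod_range_mul_le_tprod_primes
    (hl : ∀ n : ℕ, 2 ≤ n → (1 - 1 / (n : ℝ) ^ 2) ^ k ≤ f n) (hu : ∀ n : ℕ, 2 ≤ n → f n ≤ 1)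
    {M : ℕ} (hM : 2 ≤ M) :
    (∏ n ∈ range M, if n.Prime then f n else 1) * (1 - 1 / (M : ℝ)) ^ k ≤
      ∏' p : Nat.Primes, f p := by
  refine ge_of_tendsto (tendsto_prod_primes_range hl hu)
    (Filter.eventually_atTop.2 ⟨M, fun N hN ↦ ?_⟩)
  have hmono : (∏ n ∈ range M, if n.Prime then f n else 1) * (1 - 1 / (M : ℝ)) ^ k ≤
      (∏ n ∈ range N, if n.Prime then f n else 1) * (1 - 1 / (N : ℝ)) ^ k := by
    induction N, hN using Nat.le_induction with
    | base => exact le_rfl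
    | succ N hN ih =>
      refine ih.trans ?_
      have hN2 : 2 ≤ N := hM.trans hN
      have hN0 : (0 : ℝ) < N := by exact_mod_cast (by omega : 0 < N)
      have htel : 1 - 1 / (N : ℝ) = (1 - 1 / (N : ℝ) ^ 2) * (1 - 1 / ((N + 1 : ℕ) : ℝ)) := by
        push_cast
        field_simp
        ring
      have hpos : 0 ≤ 1 - 1 / ((N + 1 : ℕ) : ℝ) := by
        rw [sub_nonneg, div_le_one (by positivity)]
        push_cast
        linarith
      rw [prod_range_succ, htel, mul_pow, mul_assoc]
      refine mul_le_mul_of_nonneg_left (mul_le_mul_of_nonneg_right ?_ (pow_nonneg hpos k))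
        (prod_primes_range_nonneg hl N)
      have hsq := one_sub_one_div_sq_nonneg hN2
      split_ifs
      · exact hl N hN2
      · exact pow_le_one₀ hsq (sub_le_self _ (by positivity))
  refine hmono.trans (mul_le_of_le_one_right (prod_primes_range_nonneg hl N) ?_)
  have hN1 : (1 : ℝ) ≤ N := by exact_mod_cast (by omega : 1 ≤ N)
  refine pow_le_one₀ ?_ (sub_le_self _ (by positivity))
  rw [sub_nonneg, div_le_one (by positivity)]
  exact hN1

end PrimeProducts

theorem one_sub_sq_pow_two_le {n : ℕ} (hn : 2 ≤ n) :
    (1 - 1 / (n : ℝ) ^ 2) ^ 2 ≤ 1 - (2 * n - 1) / (n : ℝ) ^ 3 := by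
  have h : (2 : ℝ) ≤ n := by exact_mod_cast hn
  have key : 1 - (2 * n - 1) / (n : ℝ) ^ 3 - (1 - 1 / (n : ℝ) ^ 2) ^ 2 = (n - 1) / (n : ℝ) ^ 4 := by
    field_simp
    ring
  have : 0 ≤ (n - 1) / (n : ℝ) ^ 4 := div_nonneg (by linarith) (by positivity)
  linarith

theorem one_sub_sq_pow_three_le {n : ℕ} (hn : 2 ≤ n) :
    (1 - 1 / (n : ℝ) ^ 2) ^ 3 ≤ 1 - (3 * n - 2) / (n : ℝ) ^ 3 := by
  have h : (2 : ℝ) ≤ n := by exact_mod_cast hn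
  have key : 1 - (3 * n - 2) / (n : ℝ) ^ 3 - (1 - 1 / (n : ℝ) ^ 2) ^ 3 =
      (n ^ 2 * (2 * n - 3) + 1) / (n : ℝ) ^ 6 := by
    field_simp
    ring
  have : 0 ≤ (n ^ 2 * (2 * n - 3) + 1) / (n : ℝ) ^ 6 := by
    have : (0 : ℝ) ≤ 2 * n - 3 := by linarith
    positivity
  linarith

theorem one_sub_div_cube_le_one {a b : ℝ} {n : ℕ} (h : b ≤ a * n) :
    1 - (a * n - b) / (n : ℝ) ^ 3 ≤ 1 :=
  sub_le_self _ (div_nonneg (by linarith) (by positivity))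

set_option maxRecDepth 100000 in
set_option maxHeartbeats 4000000 in
theorem prod_range_two_mul_sub_one_bounds :
    (0.4283 : ℝ) ≤ ∏ n ∈ range 700, (if n.Prime then 1 - (2 * (n : ℝ) - 1) / (n : ℝ) ^ 3 else 1) ∧
    ∏ n ∈ range 700, (if n.Prime then 1 - (2 * (n : ℝ) - 1) / (n : ℝ) ^ 3 else 1) ≤ 0.4285 := by
  norm_num [prod_range_succ]

set_option maxRecDepth 100000 in
set_option maxHeartbeats 4000000 in
theorem prod_range_three_mul_sub_two_bounds :
    (0.2868 : ℝ) ≤ ∏ n ∈ range 700, (if n.Prime then 1 - (3 * (n : ℝ) - 2) / (n : ℝ) ^ 3 else 1) ∧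
    ∏ n ∈ range 700, (if n.Prime then 1 - (3 * (n : ℝ) - 2) / (n : ℝ) ^ 3 else 1) ≤ 0.2870 := by
  norm_num [prod_range_succ]

theorem rho_between_017_and_018 :
    0.17 < (1 - 3 / (Real.pi ^ 2 / 6)
        + 3 * ∏' p : Nat.Primes, (1 - (2 * (p : ℕ) - 1) / ((p : ℕ) : ℝ) ^ 3)
        - ∏' p : Nat.Primes, (1 - (3 * (p : ℕ) - 2) / ((p : ℕ) : ℝ) ^ 3)) ∧
    (1 - 3 / (Real.pi ^ 2 / 6)
        + 3 * ∏' p : Nat.Primes, (1 - (2 * (p : ℕ) - 1) / ((p : ℕ) : ℝ) ^ 3)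
        - ∏' p : Nat.Primes, (1 - (3 * (p : ℕ) - 2) / ((p : ℕ) : ℝ) ^ 3)) < 0.18 := by
  have two_le_cast {n : ℕ} (hn : 2 ≤ n) : (2 : ℝ) ≤ n := by exact_mod_cast hn
  have hu₂ (n : ℕ) (hn : 2 ≤ n) : 1 - (2 * (n : ℝ) - 1) / (n : ℝ) ^ 3 ≤ 1 :=
    one_sub_div_cube_le_one (by linarith [two_le_cast hn])
  have hu₃ (n : ℕ) (hn : 2 ≤ n) : 1 - (3 * (n : ℝ) - 2) / (n : ℝ) ^ 3 ≤ 1 :=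
    one_sub_div_cube_le_one (by linarith [two_le_cast hn])
  have h₂ := tprod_primes_le_prod_range (fun _ ↦ one_sub_sq_pow_two_le) hu₂ 700
  have h₃ := tprod_primes_le_prod_range (fun _ ↦ one_sub_sq_pow_three_le) hu₃ 700
  have h₂' := prod_range_mul_le_tprod_primes (fun _ ↦ one_sub_sq_pow_two_le) hu₂
    (by norm_num : 2 ≤ 700)
  have h₃' := prod_range_mul_le_tprod_primes (fun _ ↦ one_sub_sq_pow_three_le) hu₃
    (by norm_num : 2 ≤ 700)
  obtain ⟨hl₂, hr₂⟩ := prod_range_two_mul_sub_one_bounds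
  obtain ⟨hl₃, hr₃⟩ := prod_range_three_mul_sub_two_bounds
  have hπl : 1.8237 ≤ 3 / (Real.pi ^ 2 / 6) := by
    rw [le_div_iff₀ (by positivity)]
    nlinarith [Real.pi_lt_d4, Real.pi_pos]
  have hπu : 3 / (Real.pi ^ 2 / 6) ≤ 1.8239 := by
    rw [div_le_iff₀ (by positivity)]
    nlinarith [Real.pi_gt_d4]
  norm_num1 at h₂' h₃' ⊢
  constructor <;> linarith
end
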